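/- arXiv:0902.0621 — 2 statements merged into one kernel-verified Lean document; each statement's English description precedes it below -/
import Mathlib

section
/- For every m ∈ ℕ, the polytope P^(m) decomposes as P^(m) = P_I^(m) ∪ ⋃_{σ ∈ S_{2m+6}} σ(P_II^(m)) ∪ ⋃_{σ ∈ S_{2m+6}} σ(P_III^(m)), where the symmetric group S_{2m+6} acts on ℝ^{2m+6} by permuting coordinates and σ(A) = {σ(a) : a ∈ A}. -/
noncomputable section

open Finset

/-- Standard basis vector `e i` of `ℝ^(2m+6)`. -/
def e (m : ℕ) (i : Fin (2 * m + 6)) : Fin (2 * m + 6) → ℝ := fun k => if k = i then 1 else 0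

/-- The vector `ρ = (1/2, …, 1/2)` in `ℝ^(2m+6)`. -/
def ρ (m : ℕ) : Fin (2 * m + 6) → ℝ := fun _ => 1 / 2

/-- The vector `v_S = ∑_{j ∈ S} e_j`. -/
def vS (m : ℕ) (S : Finset (Fin (2 * m + 6))) : Fin (2 * m + 6) → ℝ := ∑ j ∈ S, e m j

/-- The vector `w_{ij} = ρ - e_i - e_j`. -/
def w (m : ℕ) (i j : Fin (2 * m + 6)) : Fin (2 * m + 6) → ℝ := ρ m - e m i - e m j

/-- The polytope `P^(m)`, convex hull of all `v_S` (`|S| = m+1`) and all `w_{ij}` (`i < j`). -/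
def P (m : ℕ) : Set (Fin (2 * m + 6) → ℝ) :=
  convexHull ℝ
    ({x | ∃ S : Finset (Fin (2 * m + 6)), S.card = m + 1 ∧ x = vS m S} ∪
      {x | ∃ i j : Fin (2 * m + 6), i < j ∧ x = w m i j})

/-- The polytope `P_I^(m)`, convex hull of all `v_S` with `|S| = m+1`. -/
def PI (m : ℕ) : Set (Fin (2 * m + 6) → ℝ) :=
  convexHull ℝ {x | ∃ S : Finset (Fin (2 * m + 6)), S.card = m + 1 ∧ x = vS m S}

/-- The polytope `P_II^(m)`, convex hull of the `v_S` with `S ⊆ {1,…,2m+5}`, `|S| = m+1`,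
together with the `w_{0j}` for `1 ≤ j ≤ 2m+5`. -/
def PII (m : ℕ) : Set (Fin (2 * m + 6) → ℝ) :=
  convexHull ℝ
    ({x | ∃ S : Finset (Fin (2 * m + 6)), S.card = m + 1 ∧ (0 : Fin (2 * m + 6)) ∉ S ∧ x = vS m S} ∪
      {x | ∃ j : Fin (2 * m + 6), j ≠ 0 ∧ x = w m 0 j})

/-- The polytope `P_III^(m)`, convex hull of the `v_S` with `S ⊆ {3,…,2m+5}`, `|S| = m+1`,
together with the `w_{ij}` for `0 ≤ i < j ≤ 2`. -/
def PIII (m : ℕ) : Set (Fin (2 * m + 6) → ℝ) :=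
  convexHull ℝ
    ({x | ∃ S : Finset (Fin (2 * m + 6)), S.card = m + 1 ∧ (∀ s ∈ S, 3 ≤ (s : ℕ)) ∧ x = vS m S} ∪
      {x | ∃ i j : Fin (2 * m + 6), (i : ℕ) < (j : ℕ) ∧ (j : ℕ) ≤ 2 ∧ x = w m i j})

theorem vS_apply (m : ℕ) (S : Finset (Fin (2 * m + 6))) (k : Fin (2 * m + 6)) :
    vS m S k = if k ∈ S then 1 else 0 := by
  simp [vS, e]

theorem w_apply (m : ℕ) (i j k : Fin (2 * m + 6)) :
    w m i j k = 1 / 2 - (if k = i then 1 else 0) - (if k = j then 1 else 0) := by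
  simp [w, e, ρ]

theorem w_comm (m : ℕ) (i j : Fin (2 * m + 6)) : w m i j = w m j i := by
  simp only [w]; abel

theorem sum_vS (m : ℕ) (S : Finset (Fin (2 * m + 6))) : ∑ k, vS m S k = S.card := by
  simp [vS_apply]

theorem sum_w (m : ℕ) (i j : Fin (2 * m + 6)) : ∑ k, w m i j k = m + 1 := by
  simp only [w_apply, sum_sub_distrib]
  simp
  ring

theorem vS_comp (m : ℕ) (S : Finset (Fin (2 * m + 6))) (σ : Equiv.Perm (Fin (2 * m + 6))) :
    vS m S ∘ σ = vS m (S.map σ.symm.toEmbedding) := by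
  ext k
  simp [vS_apply, Finset.mem_map_equiv]

theorem w_comp (m : ℕ) (i j : Fin (2 * m + 6)) (σ : Equiv.Perm (Fin (2 * m + 6))) :
    w m i j ∘ σ = w m (σ.symm i) (σ.symm j) := by
  ext k
  simp [w_apply, Equiv.eq_symm_apply]

theorem w_mem_P (m : ℕ) {i j : Fin (2 * m + 6)} (h : i ≠ j) : w m i j ∈ P m := by
  rcases lt_or_gt_of_ne h with h | h
  · exact subset_convexHull ℝ _ (Or.inr ⟨i, j, h, rfl⟩)
  · exact subset_convexHull ℝ _ (Or.inr ⟨j, i, h, w_comm m i j⟩)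

theorem vS_mem_P (m : ℕ) {S : Finset (Fin (2 * m + 6))} (h : S.card = m + 1) : vS m S ∈ P m :=
  subset_convexHull ℝ _ (Or.inl ⟨S, h, rfl⟩)

theorem convex_P (m : ℕ) : Convex ℝ (P m) := convex_convexHull ℝ _

/-- `P` is invariant under permutations of the coordinates. -/
theorem comp_mem_P (m : ℕ) (σ : Equiv.Perm (Fin (2 * m + 6))) {x : Fin (2 * m + 6) → ℝ}
    (hx : x ∈ P m) : x ∘ σ ∈ P m := by
  have hconv : Convex ℝ ((LinearMap.funLeft ℝ ℝ σ) ⁻¹' P m) :=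
    (convex_P m).linear_preimage (LinearMap.funLeft ℝ ℝ σ)
  refine convexHull_min ?_ hconv hx
  rintro _ (⟨S, hS, rfl⟩ | ⟨i, j, hij, rfl⟩)
  · change vS m S ∘ σ ∈ P m
    rw [vS_comp]
    exact vS_mem_P m (by simpa using hS)
  · change w m i j ∘ σ ∈ P m
    rw [w_comp]
    exact w_mem_P m (σ.symm.injective.ne hij.ne)

/-- A linear inequality holds on `P` as soon as it holds at the generators. -/
theorem le_of_mem_P (m : ℕ) (f : (Fin (2 * m + 6) → ℝ) →ₗ[ℝ] ℝ) (c : ℝ)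
    (hv : ∀ S : Finset (Fin (2 * m + 6)), S.card = m + 1 → c ≤ f (vS m S))
    (hw : ∀ i j : Fin (2 * m + 6), i ≠ j → c ≤ f (w m i j))
    {x : Fin (2 * m + 6) → ℝ} (hx : x ∈ P m) : c ≤ f x := by
  refine convexHull_min (t := {x | c ≤ f x}) ?_ (convex_halfSpace_ge f.isLinear c) hx
  rintro _ (⟨S, hS, rfl⟩ | ⟨i, j, hij, rfl⟩)
  · exact hv S hS
  · exact hw i j hij.ne

theorem sum_of_mem_P (m : ℕ) {x : Fin (2 * m + 6) → ℝ} (hx : x ∈ P m) :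
    ∑ j, x j = m + 1 := by
  refine le_antisymm ?_ ?_
  · have := le_of_mem_P m (-∑ j, LinearMap.proj j) (-(m + 1 : ℝ)) ?_ ?_ hx
    · simpa [add_comm] using this
    · intro S hS
      simp [sum_vS, hS, add_comm]
    · intro i j _
      simp [sum_w, add_comm]
  · have := le_of_mem_P m (∑ j, LinearMap.proj j) (m + 1 : ℝ) ?_ ?_ hx
    · simpa using this
    · intro S hS
      simp [sum_vS, hS]
    · intro i j _
      simp [sum_w]

theorem le_one_of_mem_P (m : ℕ) {x : Fin (2 * m + 6) → ℝ} (hx : x ∈ P m)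
    (i : Fin (2 * m + 6)) : x i ≤ 1 := by
  have := le_of_mem_P m (-LinearMap.proj i) (-1) ?_ ?_ hx
  · simpa using this
  · intro S _
    simp only [LinearMap.neg_apply, LinearMap.proj_apply, vS_apply]
    split_ifs <;> norm_num
  · intro a b _
    simp only [LinearMap.neg_apply, LinearMap.proj_apply, w_apply]
    split_ifs <;> norm_num

theorem neg_half_le_of_mem_P (m : ℕ) {x : Fin (2 * m + 6) → ℝ} (hx : x ∈ P m)
    (i : Fin (2 * m + 6)) : -(1 / 2) ≤ x i := by
  have := le_of_mem_P m (LinearMap.proj i) (-(1 / 2)) ?_ ?_ hx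
  · simpa using this
  · intro S _
    simp only [LinearMap.proj_apply, vS_apply]
    split_ifs <;> norm_num
  · intro a b hab
    simp only [LinearMap.proj_apply, w_apply]
    split_ifs <;> first | (exfalso; grind) | norm_num

theorem sub_le_one_of_mem_P (m : ℕ) {x : Fin (2 * m + 6) → ℝ} (hx : x ∈ P m)
    (i j : Fin (2 * m + 6)) : x j - x i ≤ 1 := by
  have := le_of_mem_P m (LinearMap.proj (R := ℝ) (φ := fun _ => ℝ) i - LinearMap.proj j) (-1) ?_ ?_ hx
  · simp only [LinearMap.sub_apply, LinearMap.proj_apply] at this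
    linarith
  · intro S _
    simp only [LinearMap.sub_apply, LinearMap.proj_apply, vS_apply]
    split_ifs <;> norm_num
  · intro a b hab
    simp only [LinearMap.sub_apply, LinearMap.proj_apply, w_apply]
    split_ifs <;> first | (exfalso; grind) | norm_num

theorem neg_half_le_add_of_mem_P (m : ℕ) {x : Fin (2 * m + 6) → ℝ} (hx : x ∈ P m)
    {i j k : Fin (2 * m + 6)} (hij : i ≠ j) (hik : i ≠ k) (hjk : j ≠ k) :
    -(1 / 2) ≤ x i + x j + x k := by
  have := le_of_mem_P m (LinearMap.proj (R := ℝ) (φ := fun _ => ℝ) i + LinearMap.proj j + LinearMap.proj k)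
    (-(1 / 2)) ?_ ?_ hx
  · simpa using this
  · intro S _
    simp only [LinearMap.add_apply, LinearMap.proj_apply, vS_apply]
    split_ifs <;> norm_num
  · intro a b hab
    simp only [LinearMap.add_apply, LinearMap.proj_apply, w_apply]
    split_ifs <;> first | (exfalso; grind) | norm_num

theorem sub_sub_sub_le_one_of_mem_P (m : ℕ) {x : Fin (2 * m + 6) → ℝ} (hx : x ∈ P m)
    {i j k : Fin (2 * m + 6)} (hij : i ≠ j) (hik : i ≠ k) (hjk : j ≠ k)
    (l : Fin (2 * m + 6)) : x l - x i - x j - x k ≤ 1 := by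
  have := le_of_mem_P m
    (LinearMap.proj (R := ℝ) (φ := fun _ => ℝ) i + LinearMap.proj j + LinearMap.proj k - LinearMap.proj l) (-1) ?_ ?_ hx
  · simp only [LinearMap.sub_apply, LinearMap.add_apply, LinearMap.proj_apply] at this
    linarith
  · intro S _
    simp only [LinearMap.sub_apply, LinearMap.add_apply, LinearMap.proj_apply, vS_apply]
    split_ifs <;> norm_num
  · intro a b hab
    simp only [LinearMap.sub_apply, LinearMap.add_apply, LinearMap.proj_apply, w_apply]
    split_ifs <;> first | (exfalso; grind) | norm_num

theorem sum_add_nonneg_of_mem_P (m : ℕ) {x : Fin (2 * m + 6) → ℝ} (hx : x ∈ P m)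
    {J : Finset (Fin (2 * m + 6))} (hJ : 3 ≤ J.card) {i : Fin (2 * m + 6)} (hi : i ∉ J) :
    0 ≤ ∑ j ∈ J, x j + ((J.card : ℝ) - 2) * x i := by
  have hJ' : (3 : ℝ) ≤ J.card := by exact_mod_cast hJ
  have := le_of_mem_P m
    (∑ j ∈ J, LinearMap.proj j + ((J.card : ℝ) - 2) • LinearMap.proj i) 0 ?_ ?_ hx
  · simpa using this
  · intro S _
    simp only [LinearMap.add_apply, LinearMap.sum_apply, LinearMap.smul_apply,
      LinearMap.proj_apply, smul_eq_mul, vS_apply]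
    refine add_nonneg (sum_nonneg fun j _ => ?_) (mul_nonneg (by linarith) ?_) <;>
      split_ifs <;> norm_num
  · intro a b hab
    simp only [LinearMap.add_apply, LinearMap.sum_apply, LinearMap.smul_apply,
      LinearMap.proj_apply, smul_eq_mul, w_apply, sum_sub_distrib, sum_ite_eq', sum_const,
      nsmul_eq_mul]
    split_ifs <;> first | (exfalso; grind) | linarith

/-- A point of the unit cube whose coordinates sum to `k` is a convex combination of indicator
functions of `k`-element sets contained in its support. -/
theorem mem_convexHull_indicator {ι : Type*} [Fintype ι] [DecidableEq ι] (k : ℕ) (p : ι → Prop)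
    (y : ι → ℝ) (h0 : ∀ j, 0 ≤ y j) (h1 : ∀ j, y j ≤ 1) (hp : ∀ j, ¬ p j → y j = 0)
    (hs : ∑ j, y j = k) :
    y ∈ convexHull ℝ {x : ι → ℝ | ∃ S : Finset ι, S.card = k ∧ (∀ s ∈ S, p s) ∧
      x = fun j => if j ∈ S then 1 else 0} := by
  classical
  induction hn : (univ.filter fun j => y j ≠ 0 ∧ y j ≠ 1).card using Nat.strong_induction_on
    generalizing y with
  | _ n ih =>
  by_cases hfrac : ∃ i, y i ≠ 0 ∧ y i ≠ 1
  · obtain ⟨i, hi0, hi1⟩ := hfrac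
    have hj : ∃ j, j ≠ i ∧ y j ≠ 0 ∧ y j ≠ 1 := by
      by_contra! hcon
      have hrest : ∑ j ∈ univ.erase i, y j =
          (((univ.erase i).filter fun j => y j ≠ 0).card : ℝ) := by
        rw [card_filter, Nat.cast_sum]
        refine sum_congr rfl fun j hj => ?_
        have := hcon j (ne_of_mem_erase hj)
        by_cases h : y j = 0 <;> simp [h, this]
      rw [← add_sum_erase _ _ (mem_univ i), hrest] at hs
      have hpos : 0 < y i := lt_of_le_of_ne (h0 i) (Ne.symm hi0)
      have hlt : y i < 1 := lt_of_le_of_ne (h1 i) hi1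
      generalize ((univ.erase i).filter fun j => y j ≠ 0).card = c at hs
      have hck : c < k := by
        have : (c : ℝ) < k := by linarith
        exact_mod_cast this
      have hkc : k < c + 1 := by
        have : (k : ℝ) < (c + 1 : ℕ) := by push_cast; linarith
        exact_mod_cast this
      omega
    obtain ⟨j, hji, hj0, hj1⟩ := hj
    have hstep : ∀ a b : ι, a ≠ b → y a ≠ 0 → y a ≠ 1 → y b ≠ 0 → y b ≠ 1 →
        (y + (min (1 - y a) (y b)) • (Pi.single a 1 - Pi.single b 1 : ι → ℝ)) ∈
          convexHull ℝ {x : ι → ℝ | ∃ S : Finset ι, S.card = k ∧ (∀ s ∈ S, p s) ∧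
            x = fun j => if j ∈ S then 1 else 0} := by
      intro a b hab ha0 ha1 hb0 hb1
      set s := min (1 - y a) (y b) with hsdef
      have hs1 : s ≤ 1 - y a := min_le_left _ _
      have hs2 : s ≤ y b := min_le_right _ _
      have hspos : 0 ≤ s := le_min (by linarith [h1 a]) (h0 b)
      set z : ι → ℝ := y + s • (Pi.single a 1 - Pi.single b 1 : ι → ℝ) with hz
      have hza : z a = y a + s := by simp [hz, hab]
      have hzb : z b = y b - s := by simp [hz, hab.symm]; ring
      have hzo : ∀ c, c ≠ a → c ≠ b → z c = y c := by
        intro c hca hcb; simp [hz, hca, hcb]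
      have hpa : p a := by by_contra h; exact ha0 (hp a h)
      have hpb : p b := by by_contra h; exact hb0 (hp b h)
      refine ih _ ?_ z ?_ ?_ ?_ ?_ rfl
      · rw [← hn]
        refine card_lt_card ?_
        have hsub : (univ.filter fun j => z j ≠ 0 ∧ z j ≠ 1) ⊆
            univ.filter fun j => y j ≠ 0 ∧ y j ≠ 1 := by
          intro c hc
          simp only [mem_filter, mem_univ, true_and] at hc ⊢
          by_cases hca : c = a
          · subst hca; exact ⟨ha0, ha1⟩
          by_cases hcb : c = b
          · subst hcb; exact ⟨hb0, hb1⟩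
          rwa [hzo c hca hcb] at hc
        refine (ssubset_iff_of_subset hsub).2 ?_
        rcases min_choice (1 - y a) (y b) with h | h
        · refine ⟨a, by simp [ha0, ha1], ?_⟩
          have : z a = 1 := by rw [hza, hsdef, h]; ring
          simp [this]
        · refine ⟨b, by simp [hb0, hb1], ?_⟩
          have : z b = 0 := by rw [hzb, hsdef, h]; ring
          simp [this]
      · intro c
        by_cases hca : c = a
        · subst hca; rw [hza]; linarith [h0 c]
        by_cases hcb : c = b
        · subst hcb; rw [hzb]; linarith
        rw [hzo c hca hcb]; exact h0 c
      · intro c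
        by_cases hca : c = a
        · subst hca; rw [hza]; linarith
        by_cases hcb : c = b
        · subst hcb; rw [hzb]; linarith [h1 c]
        rw [hzo c hca hcb]; exact h1 c
      · intro c hc
        rw [hzo c (by rintro rfl; exact hc hpa) (by rintro rfl; exact hc hpb)]
        exact hp c hc
      · simp [hz, sum_add_distrib, ← mul_sum, sum_sub_distrib, hs]
    have hA := hstep i j hji.symm hi0 hi1 hj0 hj1
    have hB := hstep j i hji hj0 hj1 hi0 hi1
    have hspos : 0 < min (1 - y i) (y j) :=
      lt_min (by linarith [lt_of_le_of_ne (h1 i) hi1]) (lt_of_le_of_ne (h0 j) (Ne.symm hj0))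
    have hrpos : 0 < min (1 - y j) (y i) :=
      lt_min (by linarith [lt_of_le_of_ne (h1 j) hj1]) (lt_of_le_of_ne (h0 i) (Ne.symm hi0))
    generalize min (1 - y i) (y j) = s at *
    generalize min (1 - y j) (y i) = r at *
    have hsr : s + r ≠ 0 := by positivity
    have := (convex_convexHull ℝ _) hA hB (a := r / (s + r)) (b := s / (s + r))
      (by positivity) (by positivity) (by field_simp; ring)
    convert this using 1
    ext c
    simp only [Pi.add_apply, Pi.smul_apply, Pi.sub_apply, smul_eq_mul]
    field_simp
    ring
  · push Not at hfrac
    refine subset_convexHull ℝ _ ⟨univ.filter fun j => y j ≠ 0, ?_, ?_, ?_⟩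
    · have : ((univ.filter fun j => y j ≠ 0).card : ℝ) = k := by
        rw [← hs, card_filter, Nat.cast_sum]
        refine sum_congr rfl fun j _ => ?_
        by_cases h : y j = 0 <;> simp [h, hfrac]
      exact_mod_cast this
    · intro s hs
      by_contra h
      exact (mem_filter.1 hs).2 (hp s h)
    · ext j
      by_cases h : y j = 0 <;> simp [h, hfrac]

theorem mem_of_cube (m : ℕ) {K : Set (Fin (2 * m + 6) → ℝ)} (hK : Convex ℝ K)
    (p : Fin (2 * m + 6) → Prop)
    (hv : ∀ S : Finset (Fin (2 * m + 6)), S.card = m + 1 → (∀ s ∈ S, p s) → vS m S ∈ K)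
    (y : Fin (2 * m + 6) → ℝ) (h0 : ∀ j, 0 ≤ y j) (h1 : ∀ j, y j ≤ 1)
    (hp : ∀ j, ¬ p j → y j = 0) (hs : ∑ j, y j = m + 1) : y ∈ K := by
  refine convexHull_min ?_ hK
    (mem_convexHull_indicator (m + 1) p y h0 h1 hp (by push_cast; exact hs))
  rintro _ ⟨S, hS, hpS, rfl⟩
  convert hv S hS hpS using 1
  ext j
  rw [vS_apply]

theorem exists_card_eq_three_le (m : ℕ) :
    ∃ S : Finset (Fin (2 * m + 6)), S.card = m + 1 ∧ ∀ s ∈ S, 3 ≤ (s : ℕ) := by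
  have h : m + 1 ≤ (Finset.Ici (⟨3, by omega⟩ : Fin (2 * m + 6))).card := by
    rw [Fin.card_Ici]; simp only; omega
  obtain ⟨S, hS, hc⟩ := exists_subset_card_eq h
  exact ⟨S, hc, fun s hs => by simpa [Fin.le_def] using hS hs⟩

/-- If `x - B • z` lies in the `1 - B` multiple of a face of the hypersimplex, then `x` lies in any
convex set containing `z` and the vertices of that face. -/
theorem mem_of_sub_smul (m : ℕ) {K : Set (Fin (2 * m + 6) → ℝ)} (hK : Convex ℝ K)
    (p : Fin (2 * m + 6) → Prop) (hp3 : ∀ j : Fin (2 * m + 6), 3 ≤ (j : ℕ) → p j)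
    (hv : ∀ S : Finset (Fin (2 * m + 6)), S.card = m + 1 → (∀ s ∈ S, p s) → vS m S ∈ K)
    {x z : Fin (2 * m + 6) → ℝ} {B : ℝ} (hz : z ∈ K) (hB0 : 0 ≤ B) (hB1 : B ≤ 1)
    (hxs : ∑ j, x j = m + 1) (hzs : ∑ j, z j = m + 1)
    (h0 : ∀ j, 0 ≤ x j - B * z j) (h1 : ∀ j, x j - B * z j ≤ 1 - B)
    (hp : ∀ j, ¬ p j → x j - B * z j = 0) : x ∈ K := by
  have key : ∃ y ∈ K, ∀ j, x j - B * z j = (1 - B) * y j := by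
    rcases hB1.eq_or_lt with rfl | hB
    · obtain ⟨S, hS, hS3⟩ := exists_card_eq_three_le m
      refine ⟨_, hv S hS fun s hs => hp3 s (hS3 s hs), fun j => ?_⟩
      linarith [h0 j, h1 j]
    · have hpos : 0 < 1 - B := by linarith
      refine ⟨fun j => (x j - B * z j) / (1 - B), ?_, fun j => by field_simp⟩
      refine mem_of_cube m hK p hv _ (fun j => div_nonneg (h0 j) hpos.le)
        (fun j => (div_le_one hpos).2 (h1 j)) (fun j hj => by simp [hp j hj]) ?_
      rw [← sum_div, sum_sub_distrib, ← mul_sum, hxs, hzs]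
      field_simp
  obtain ⟨y, hy, hxy⟩ := key
  have := hK hy hz (a := 1 - B) (b := B) (by linarith) hB0 (by ring)
  convert this using 1
  ext j
  simp only [Pi.add_apply, Pi.smul_apply, smul_eq_mul]
  linarith [hxy j]

theorem mem_PII (m : ℕ) {x b : Fin (2 * m + 6) → ℝ} {t : ℝ} (ht : 0 < t) (ht2 : t ≤ 1 / 2)
    (hx0 : x 0 = -t) (hxs : ∑ j, x j = m + 1) (hb : ∀ j, 0 ≤ b j) (hb0 : b 0 = 0)
    (hbs : ∑ j, b j = 2 * t) (hl : ∀ j, j ≠ 0 → t - x j ≤ b j)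
    (hu : ∀ j, j ≠ 0 → b j ≤ 1 - t - x j) : x ∈ PII m := by
  set z : Fin (2 * m + 6) → ℝ := ∑ i ∈ univ.erase 0, (b i / (2 * t)) • w m 0 i with hz
  have hbs' : ∑ i ∈ univ.erase 0, b i = 2 * t := by
    rw [← hbs, ← add_sum_erase _ _ (mem_univ 0), hb0, zero_add]
  have hzK : z ∈ PII m := by
    refine (convex_convexHull ℝ _).sum_mem (fun i _ => div_nonneg (hb i) (by positivity)) ?_ ?_
    · rw [← sum_div, hbs']; field_simp
    · intro i hi
      exact subset_convexHull ℝ _ (Or.inr ⟨i, ne_of_mem_erase hi, rfl⟩)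
  have hzj : ∀ j, 2 * t * z j = ∑ i ∈ univ.erase 0, b i * w m 0 i j := by
    intro j
    simp only [hz, Finset.sum_apply, Pi.smul_apply, smul_eq_mul, mul_sum]
    refine sum_congr rfl fun i _ => by field_simp
  have hzs : ∑ j, z j = m + 1 := by
    have : 2 * t * ∑ j, z j = 2 * t * (m + 1) := by
      rw [mul_sum]
      simp_rw [hzj]
      rw [sum_comm]
      simp_rw [← mul_sum, sum_w]
      rw [← sum_mul, hbs']
    exact mul_left_cancel₀ (by positivity) this
  have hval : ∀ j, j ≠ 0 → 2 * t * z j = t - b j := by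
    intro j hj
    rw [hzj]
    simp only [w_apply, mul_sub, sum_sub_distrib, hj, ← sum_mul, hbs']
    simp [hj]
    ring
  have hval0 : 2 * t * z 0 = -t := by
    rw [hzj]
    simp only [w_apply, mul_sub, sum_sub_distrib, ← sum_mul, hbs']
    simp
    linarith
  refine mem_of_sub_smul m (convex_convexHull ℝ _) (fun j => j ≠ 0) ?_ ?_ hzK
    (B := 2 * t) (by positivity) (by linarith) hxs hzs ?_ ?_ ?_
  · rintro j hj rfl
    simp at hj
  · intro S hS hS0
    exact subset_convexHull ℝ _ (Or.inl ⟨S, hS, fun h => hS0 0 h rfl, rfl⟩)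
  · intro j
    by_cases hj : j = 0
    · subst hj; rw [hval0]; linarith
    · rw [hval j hj]; linarith [hl j hj]
  · intro j
    by_cases hj : j = 0
    · subst hj; rw [hval0]; linarith
    · rw [hval j hj]; linarith [hu j hj]
  · intro j hj
    rw [not_not.1 hj, hval0]
    linarith

theorem mem_PIII (m : ℕ) {x : Fin (2 * m + 6) → ℝ} {t : ℝ} (ht : 0 < t) (ht2 : t ≤ 1 / 2)
    {i₁ i₂ : Fin (2 * m + 6)} (hi₁ : (i₁ : ℕ) = 1) (hi₂ : (i₂ : ℕ) = 2)
    (hx : x 0 + x i₁ + x i₂ = -t) (h0 : -t ≤ x 0) (h1 : -t ≤ x i₁) (h2 : -t ≤ x i₂)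
    (hxs : ∑ j, x j = m + 1) (hl : ∀ j : Fin (2 * m + 6), 3 ≤ (j : ℕ) → t ≤ x j)
    (hu : ∀ j : Fin (2 * m + 6), 3 ≤ (j : ℕ) → x j ≤ 1 - t) : x ∈ PIII m := by
  have hcases : ∀ j : Fin (2 * m + 6), 3 ≤ (j : ℕ) ∨ j = 0 ∨ j = i₁ ∨ j = i₂ := by
    intro j
    simp only [Fin.ext_iff, hi₁, hi₂, Fin.val_zero]
    omega
  have h01 : (0 : Fin (2 * m + 6)) ≠ i₁ := by simp [Fin.ext_iff, hi₁]
  have h02 : (0 : Fin (2 * m + 6)) ≠ i₂ := by simp [Fin.ext_iff, hi₂]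
  have h12 : i₁ ≠ i₂ := by simp [Fin.ext_iff, hi₁, hi₂]
  have hmem : ∀ i j : Fin (2 * m + 6), (i : ℕ) < (j : ℕ) → (j : ℕ) ≤ 2 → w m i j ∈ PIII m :=
    fun i j hij hj => subset_convexHull ℝ _ (Or.inr ⟨i, j, hij, hj, rfl⟩)
  set z : Fin (2 * m + 6) → ℝ := ((t + x i₂) / (2 * t)) • w m 0 i₁ +
    ((t + x i₁) / (2 * t)) • w m 0 i₂ + ((t + x 0) / (2 * t)) • w m i₁ i₂ with hz
  have hc : (t + x i₂) / (2 * t) + (t + x i₁) / (2 * t) + (t + x 0) / (2 * t) = 1 := by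
    field_simp
    linarith
  have hzK : z ∈ PIII m := by
    have := (convex_convexHull ℝ _).sum_mem (t := univ)
      (w := ![(t + x i₂) / (2 * t), (t + x i₁) / (2 * t), (t + x 0) / (2 * t)])
      (z := ![w m 0 i₁, w m 0 i₂, w m i₁ i₂]) (s := PIII m) ?_ ?_ ?_
    · simpa [Fin.sum_univ_three] using this
    · intro i _
      fin_cases i <;> simp <;> apply div_nonneg <;> linarith
    · simpa [Fin.sum_univ_three] using hc
    · intro i _
      fin_cases i
      · exact hmem _ _ (by simp [hi₁]) (by omega)
      · exact hmem _ _ (by simp [hi₂]) (by omega)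
      · exact hmem _ _ (by omega) (by omega)
  have hzj : ∀ j, 2 * t * z j =
      (t + x i₂) * w m 0 i₁ j + (t + x i₁) * w m 0 i₂ j + (t + x 0) * w m i₁ i₂ j := by
    intro j
    simp only [hz, Pi.add_apply, Pi.smul_apply, smul_eq_mul]
    field_simp
  have hzs : ∑ j, z j = m + 1 := by
    simp only [hz, Pi.add_apply, Pi.smul_apply, smul_eq_mul, sum_add_distrib, ← mul_sum, sum_w]
    rw [← add_mul, ← add_mul, hc, one_mul]
  have hbig : ∀ j : Fin (2 * m + 6), 3 ≤ (j : ℕ) → 2 * t * z j = t := by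
    intro j hj
    have hj0 : j ≠ 0 := by rintro rfl; simp at hj
    have hj1 : j ≠ i₁ := by rintro rfl; omega
    have hj2 : j ≠ i₂ := by rintro rfl; omega
    rw [hzj]
    simp only [w_apply, hj0, hj1, hj2, if_false]
    linarith
  have hsmall : ∀ j : Fin (2 * m + 6), ¬ 3 ≤ (j : ℕ) → x j - 2 * t * z j = 0 := by
    intro j hj
    rw [hzj]
    rcases (hcases j).resolve_left hj with rfl | rfl | rfl
    · simp only [w_apply, h01, h02, if_true, if_false]; linarith
    · simp only [w_apply, h01.symm, h12, if_true, if_false]; linarith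
    · simp only [w_apply, h02.symm, h12.symm, if_true, if_false]; linarith
  refine mem_of_sub_smul m (convex_convexHull ℝ _) (fun j => 3 ≤ (j : ℕ)) (fun _ h => h) ?_ hzK
    (B := 2 * t) (by positivity) (by linarith) hxs hzs ?_ ?_ hsmall
  · intro S hS hS3
    exact subset_convexHull ℝ _ (Or.inl ⟨S, hS, hS3, rfl⟩)
  · intro j
    by_cases hj : 3 ≤ (j : ℕ)
    · rw [hbig j hj]; linarith [hl j hj]
    · rw [hsmall j hj]
  · intro j
    by_cases hj : 3 ≤ (j : ℕ)
    · rw [hbig j hj]; linarith [hu j hj]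
    · rw [hsmall j hj]; linarith

theorem exists_between_sum_eq {ι : Type*} (s : Finset ι) (l u : ι → ℝ) (c : ℝ)
    (hlu : ∀ j ∈ s, l j ≤ u j) (hl : ∑ j ∈ s, l j ≤ c) (hu : c ≤ ∑ j ∈ s, u j) :
    ∃ b : ι → ℝ, (∀ j ∈ s, l j ≤ b j ∧ b j ≤ u j) ∧ ∑ j ∈ s, b j = c := by
  rcases (hl.trans hu).eq_or_lt with h | h
  · exact ⟨l, fun j hj => ⟨le_rfl, hlu j hj⟩, le_antisymm hl (h ▸ hu)⟩
  · set θ := (c - ∑ j ∈ s, l j) / (∑ j ∈ s, u j - ∑ j ∈ s, l j) with hθ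
    have hpos : 0 < ∑ j ∈ s, u j - ∑ j ∈ s, l j := by linarith
    have hθ0 : 0 ≤ θ := div_nonneg (by linarith) hpos.le
    have hθ1 : θ ≤ 1 := (div_le_one hpos).2 (by linarith)
    refine ⟨fun j => l j + θ * (u j - l j), fun j hj => ⟨?_, ?_⟩, ?_⟩
    · nlinarith [hlu j hj]
    · nlinarith [hlu j hj]
    · rw [sum_add_distrib, ← mul_sum, sum_sub_distrib, hθ, div_mul_cancel₀ _ hpos.ne']
      ring

/-- A point of `P` with sorted coordinates and negative first coordinate lies in `PII` or `PIII`. -/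
theorem mem_PII_or_mem_PIII (m : ℕ) {x : Fin (2 * m + 6) → ℝ} (hx : x ∈ P m) (hmono : Monotone x)
    (hneg : x 0 < 0) : x ∈ PII m ∨ x ∈ PIII m := by
  obtain ⟨i₁, hi₁⟩ : ∃ i : Fin (2 * m + 6), (i : ℕ) = 1 := ⟨⟨1, by omega⟩, rfl⟩
  obtain ⟨i₂, hi₂⟩ : ∃ i : Fin (2 * m + 6), (i : ℕ) = 2 := ⟨⟨2, by omega⟩, rfl⟩
  have h01 : (0 : Fin (2 * m + 6)) ≠ i₁ := by simp [Fin.ext_iff, hi₁]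
  have h02 : (0 : Fin (2 * m + 6)) ≠ i₂ := by simp [Fin.ext_iff, hi₂]
  have h12 : i₁ ≠ i₂ := by simp [Fin.ext_iff, hi₁, hi₂]
  have hle01 : x 0 ≤ x i₁ := hmono (by simp)
  have hle12 : x i₁ ≤ x i₂ := hmono (by rw [Fin.le_def]; omega)
  have hxs := sum_of_mem_P m hx
  by_cases h : x i₁ + x i₂ < 0
  · right
    refine mem_PIII m (t := -(x 0 + x i₁ + x i₂)) (by linarith) ?_ hi₁ hi₂ (by ring)
      (by linarith) (by linarith) (by linarith) hxs ?_ ?_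
    · linarith [neg_half_le_add_of_mem_P m hx h01 h02 h12]
    · intro j hj
      have hj0 : j ≠ 0 := by rintro rfl; simp at hj
      have hj1 : i₁ ≠ j := by rintro rfl; omega
      have hj2 : i₂ ≠ j := by rintro rfl; omega
      have hcard : ({i₁, i₂, j} : Finset (Fin (2 * m + 6))).card = 3 :=
        card_eq_three.2 ⟨_, _, _, h12, hj1, hj2, rfl⟩
      have := sum_add_nonneg_of_mem_P m hx hcard.ge (i := 0) (by simp [h01, h02, hj0.symm])
      rw [hcard, sum_insert (by simp [h12, hj1]), sum_pair hj2] at this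
      push_cast at this
      linarith
    · intro j _
      linarith [sub_sub_sub_le_one_of_mem_P m hx h01 h02 h12 j]
  · left
    push Not at h
    set t := -x 0 with ht
    have ht2 : t ≤ 1 / 2 := by linarith [neg_half_le_of_mem_P m hx 0]
    have hlow : ∑ j ∈ univ.erase 0, max 0 (t - x j) ≤ 2 * t := by
      set J := (univ.erase 0).filter fun j => x j < t with hJ
      have hJ0 : (0 : Fin (2 * m + 6)) ∉ J := by simp [hJ]
      have hsum : ∑ j ∈ univ.erase 0, max 0 (t - x j) = J.card * t - ∑ j ∈ J, x j := by
        rw [← nsmul_eq_mul, ← sum_const, ← sum_sub_distrib, hJ, sum_filter]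
        refine sum_congr rfl fun j _ => ?_
        split_ifs with hj
        · exact max_eq_right (by linarith)
        · exact max_eq_left (by linarith)
      rw [hsum]
      rcases Nat.lt_or_ge J.card 3 with hlt | hge
      · have hc : J.card = 0 ∨ J.card = 1 ∨ J.card = 2 := by omega
        rcases hc with hc | hc | hc
        · rw [card_eq_zero.1 hc]
          simp only [card_empty, sum_empty]
          push_cast
          linarith
        · obtain ⟨a, ha⟩ := card_eq_one.1 hc
          rw [ha, card_singleton, sum_singleton]
          push_cast
          linarith [hmono (Fin.zero_le a)]
        · obtain ⟨a, b, hab, hJab⟩ := card_eq_two.1 hc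
          rw [hJab, card_pair hab, sum_pair hab]
          push_cast
          have hle : ∀ a b : Fin (2 * m + 6), a ≠ 0 → a < b → 0 ≤ x a + x b := by
            intro a b ha hlt
            have ha' : (a : ℕ) ≠ 0 := fun h => ha (Fin.ext (by simpa using h))
            have h1 : x i₁ ≤ x a := hmono (by rw [Fin.le_def]; omega)
            have h2 : x i₂ ≤ x b := hmono (by rw [Fin.lt_def] at hlt; rw [Fin.le_def]; omega)
            linarith
          have ha0 : a ≠ 0 := by rintro rfl; exact hJ0 (by simp [hJab])
          have hb0 : b ≠ 0 := by rintro rfl; exact hJ0 (by simp [hJab])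
          rcases lt_or_gt_of_ne hab with hlt | hlt
          · linarith [hle a b ha0 hlt]
          · linarith [hle b a hb0 hlt]
      · have := sum_add_nonneg_of_mem_P m hx hge hJ0
        rw [ht]
        linarith
    have hup : 2 * t ≤ ∑ j ∈ univ.erase 0, (1 - t - x j) := by
      have hrest : ∑ j ∈ univ.erase 0, x j = m + 1 + t := by
        rw [← add_sum_erase _ _ (mem_univ 0)] at hxs
        linarith
      rw [sum_sub_distrib, hrest, sum_const, card_erase_of_mem (mem_univ _), card_univ,
        Fintype.card_fin, nsmul_eq_mul]
      push_cast [Nat.add_sub_cancel]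
      have : (0 : ℝ) ≤ m := Nat.cast_nonneg m
      nlinarith
    obtain ⟨b, hb, hbs⟩ := exists_between_sum_eq (univ.erase 0) (fun j => max 0 (t - x j))
      (fun j => 1 - t - x j) (2 * t) (fun j _ => max_le
        (by linarith [sub_le_one_of_mem_P m hx 0 j]) (by linarith)) hlow hup
    refine mem_PII m (t := t) (b := fun j => if j = 0 then 0 else b j) (by linarith) ht2
      (by linarith) hxs ?_ (by simp) ?_ ?_ ?_
    · intro j
      by_cases hj : j = 0
      · simp [hj]
      · simpa [hj] using (le_max_left _ _).trans (hb j (by simp [hj])).1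
    · rw [← hbs, ← add_sum_erase _ _ (mem_univ 0), if_pos rfl, zero_add]
      exact sum_congr rfl fun j hj => if_neg (ne_of_mem_erase hj)
    · intro j hj
      simp only [hj, if_false]
      exact (le_max_right _ _).trans (hb j (by simp [hj])).1
    · intro j hj
      simp only [hj, if_false]
      exact (hb j (by simp [hj])).2

theorem PI_subset_P (m : ℕ) : PI m ⊆ P m :=
  convexHull_mono Set.subset_union_left

theorem PII_subset_P (m : ℕ) : PII m ⊆ P m := by
  refine convexHull_min ?_ (convex_P m)
  rintro _ (⟨S, hS, -, rfl⟩ | ⟨j, hj, rfl⟩)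
  · exact vS_mem_P m hS
  · exact w_mem_P m hj.symm

theorem PIII_subset_P (m : ℕ) : PIII m ⊆ P m := by
  refine convexHull_min ?_ (convex_P m)
  rintro _ (⟨S, hS, -, rfl⟩ | ⟨i, j, hij, -, rfl⟩)
  · exact vS_mem_P m hS
  · exact w_mem_P m (Fin.ne_of_lt hij)

theorem statement3 (m : ℕ) :
    P m =
      PI m ∪
        (⋃ σ : Equiv.Perm (Fin (2 * m + 6)), (fun a => a ∘ σ) '' PII m) ∪
        (⋃ σ : Equiv.Perm (Fin (2 * m + 6)), (fun a => a ∘ σ) '' PIII m) := by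
  apply Set.Subset.antisymm
  · intro x hx
    by_cases hnn : ∀ j, 0 ≤ x j
    · exact Or.inl (Or.inl (mem_of_cube m (convex_convexHull ℝ _) (fun _ => True)
        (fun S hS _ => subset_convexHull ℝ {x | ∃ S, #S = m + 1 ∧ x = vS m S} ⟨S, hS, rfl⟩)
        x hnn (le_one_of_mem_P m hx)
        (fun _ h => absurd trivial h) (sum_of_mem_P m hx)))
    · push Not at hnn
      obtain ⟨i, hi⟩ := hnn
      set τ := Tuple.sort x
      have hmono : Monotone (x ∘ τ) := Tuple.monotone_sort x
      have hneg : (x ∘ τ) 0 < 0 := by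
        refine (hmono (Fin.zero_le (τ.symm i))).trans_lt ?_
        simpa using hi
      have hback : (x ∘ τ) ∘ τ.symm = x := by
        ext j
        simp
      rcases mem_PII_or_mem_PIII m (comp_mem_P m τ hx) hmono hneg with h | h
      · exact Or.inl (Or.inr (Set.mem_iUnion.2 ⟨τ.symm, _, h, hback⟩))
      · exact Or.inr (Set.mem_iUnion.2 ⟨τ.symm, _, h, hback⟩)
  · rintro x ((hx | hx) | hx)
    · exact PI_subset_P m hx
    · obtain ⟨σ, a, ha, rfl⟩ := Set.mem_iUnion.1 hx
      exact comp_mem_P m σ (PII_subset_P m ha)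
    · obtain ⟨σ, a, ha, rfl⟩ := Set.mem_iUnion.1 hx
      exact comp_mem_P m σ (PIII_subset_P m ha)
end
end

section
/- For every m ∈ ℕ, the polytope P_II^(m) equals the set of α ∈ ℝ^{2m+6} satisfying Σ_{i=0}^{2m+5} α_i = m+1 together with: (i) −1/2 ≤ α_0; (ii) α_r − α_0 ≤ 1 for all 1 ≤ r ≤ 2m+5; (iii) (|S|−2)α_0 + Σ_{j∈S} α_j ≥ 0 for every S ⊆ {1,…,2m+5} with 0 ≤ |S| ≤ m+3. -/
noncomputable section

open Finset

/-- A point of the unit cube with integral coordinate sum that has one coordinate strictly between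
`0` and `1` has another one. -/
lemma exists_ne_fractional {ι : Type*} [Fintype ι] {k : ℕ} {x : ι → ℝ}
    (h₀ : ∀ i, 0 ≤ x i) (h₁ : ∀ i, x i ≤ 1) (hs : ∑ i, x i = k) {i : ι} (hi : 0 < x i ∧ x i < 1) :
    ∃ j, j ≠ i ∧ 0 < x j ∧ x j < 1 := by
  classical
  by_contra! h
  have h_int : ∀ j ∈ univ.erase i, x j = if x j = 1 then 1 else 0 := by
    intro j hj
    split_ifs with h1
    · exact h1
    · by_contra h0
      exact h1 (le_antisymm (h₁ j)
        (h j (ne_of_mem_erase hj) (lt_of_le_of_ne (h₀ j) (Ne.symm h0))))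
  rw [← add_sum_erase _ _ (mem_univ i), sum_congr rfl h_int, sum_boole] at hs
  set c := #{j ∈ univ.erase i | x j = 1}
  have hlt : (c : ℝ) < k := by linarith [hi.1]
  have hgt : (k : ℝ) < c + 1 := by linarith [hi.2]
  have hlt' : c < k := by exact_mod_cast hlt
  have hgt' : k < c + 1 := by exact_mod_cast hgt
  omega

/-- The face of the hypersimplex of points supported on `T`, described by inequalities. -/
def hypersimplexOn {ι : Type*} [Fintype ι] (T : Finset ι) (k : ℕ) : Set (ι → ℝ) :=
  {x | (∀ i, 0 ≤ x i) ∧ (∀ i, x i ≤ 1) ∧ (∀ i ∉ T, x i = 0) ∧ ∑ i, x i = k}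

lemma convex_hypersimplexOn {ι : Type*} [Fintype ι] (T : Finset ι) (k : ℕ) :
    Convex ℝ (hypersimplexOn T k) := by
  rintro x ⟨hx₀, hx₁, hxT, hxs⟩ y ⟨hy₀, hy₁, hyT, hys⟩ a b ha hb hab
  refine ⟨fun i => ?_, fun i => ?_, fun i hi => ?_, ?_⟩ <;>
    simp only [Pi.add_apply, Pi.smul_apply, smul_eq_mul]
  · have := hx₀ i
    have := hy₀ i
    positivity
  · nlinarith [mul_le_mul_of_nonneg_left (hx₁ i) ha, mul_le_mul_of_nonneg_left (hy₁ i) hb]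
  · simp [hxT i hi, hyT i hi]
  · rw [sum_add_distrib, ← mul_sum, ← mul_sum, hxs, hys, ← add_mul, hab, one_mul]

lemma isCompact_hypersimplexOn {ι : Type*} [Fintype ι] (T : Finset ι) (k : ℕ) :
    IsCompact (hypersimplexOn T k) := by
  refine (isCompact_Icc (a := (0 : ι → ℝ)) (b := 1)).of_isClosed_subset ?_
    fun x hx => ⟨hx.1, hx.2.1⟩
  simp only [hypersimplexOn, Set.ofPred_and, Set.ofPred_forall]
  refine IsClosed.inter ?_ (IsClosed.inter ?_ (IsClosed.inter ?_ ?_))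
  · exact isClosed_iInter fun i => isClosed_le continuous_const (continuous_apply i)
  · exact isClosed_iInter fun i => isClosed_le (continuous_apply i) continuous_const
  · exact isClosed_iInter fun i => isClosed_iInter fun _ =>
      isClosed_eq (continuous_apply i) continuous_const
  · exact isClosed_eq (by fun_prop) continuous_const

/-- Moving a small amount of mass between two fractional coordinates stays in the hypersimplex. -/
lemma transfer_mem_hypersimplexOn {ι : Type*} [Fintype ι] [DecidableEq ι] {T : Finset ι} {k : ℕ}
    {x : ι → ℝ} (hx : x ∈ hypersimplexOn T k) {i j : ι} (hij : j ≠ i) {δ : ℝ}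
    (hi : 0 ≤ x i + δ ∧ x i + δ ≤ 1) (hj : 0 ≤ x j - δ ∧ x j - δ ≤ 1) (hiT : i ∈ T)
    (hjT : j ∈ T) : x + (Pi.single i δ - Pi.single j δ) ∈ hypersimplexOn T k := by
  obtain ⟨h₀, h₁, hT, hs⟩ := hx
  have hval : ∀ l, (x + (Pi.single i δ - Pi.single j δ) : ι → ℝ) l =
      if l = i then x i + δ else if l = j then x j - δ else x l := by
    intro l
    by_cases hli : l = i
    · subst hli
      simp [hij.symm]
    · by_cases hlj : l = j
      · subst hlj
        simp [hli, sub_eq_add_neg]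
      · simp [hli, hlj]
  refine ⟨fun l => ?_, fun l => ?_, fun l hl => ?_, ?_⟩
  · rw [hval]
    split_ifs
    exacts [hi.1, hj.1, h₀ l]
  · rw [hval]
    split_ifs
    exacts [hi.2, hj.2, h₁ l]
  · rw [hval, if_neg (by rintro rfl; exact hl hiT), if_neg (by rintro rfl; exact hl hjT), hT l hl]
  · simp [sum_add_distrib, hs]

lemma extremePoints_hypersimplexOn_eq_zero_or_one {ι : Type*} [Fintype ι] {T : Finset ι} {k : ℕ}
    {x : ι → ℝ} (hx : x ∈ (hypersimplexOn T k).extremePoints ℝ) (i : ι) : x i = 0 ∨ x i = 1 := by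
  classical
  obtain ⟨hmem, hext⟩ := hx
  obtain ⟨h₀, h₁, hT, hs⟩ := hmem
  by_contra! hne
  have hi : 0 < x i ∧ x i < 1 :=
    ⟨lt_of_le_of_ne (h₀ i) hne.1.symm, lt_of_le_of_ne (h₁ i) hne.2⟩
  obtain ⟨j, hji, hj⟩ := exists_ne_fractional h₀ h₁ hs hi
  have hsupp : ∀ l, 0 < x l → l ∈ T := fun l hl => by
    by_contra h
    exact hl.ne' (hT l h)
  obtain ⟨ε, hε, hεlt⟩ := exists_between
    (lt_min (lt_min hi.1 (sub_pos.2 hi.2)) (lt_min hj.1 (sub_pos.2 hj.2)))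
  simp only [lt_min_iff] at hεlt
  obtain ⟨⟨hε₁, hε₂⟩, hε₃, hε₄⟩ := hεlt
  have hp := transfer_mem_hypersimplexOn ⟨h₀, h₁, hT, hs⟩ hji (δ := ε)
    ⟨by linarith, by linarith⟩ ⟨by linarith, by linarith⟩ (hsupp i hi.1) (hsupp j hj.1)
  have hn := transfer_mem_hypersimplexOn ⟨h₀, h₁, hT, hs⟩ hji (δ := -ε)
    ⟨by linarith, by linarith⟩ ⟨by linarith, by linarith⟩ (hsupp i hi.1) (hsupp j hj.1)
  have hmid : x ∈ openSegment ℝ (x + (Pi.single i ε - Pi.single j ε))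
      (x + (Pi.single i (-ε) - Pi.single j (-ε))) := by
    refine ⟨1 / 2, 1 / 2, by norm_num, by norm_num, by norm_num, ?_⟩
    simp only [Pi.single_neg]
    module
  have := congrFun (hext hp hn hmid) i
  simp [hji.symm] at this
  exact hε.ne' this

/-- The hypersimplex is the convex hull of its `0`/`1` points. -/
lemma hypersimplexOn_subset_convexHull {ι : Type*} [Fintype ι] [DecidableEq ι] (T : Finset ι)
    (k : ℕ) : hypersimplexOn T k ⊆
      convexHull ℝ {x | ∃ S : Finset ι, #S = k ∧ S ⊆ T ∧ x = fun i => if i ∈ S then 1 else 0} := by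
  set V : Set (ι → ℝ) := {x | ∃ S : Finset ι, #S = k ∧ S ⊆ T ∧ x = fun i => if i ∈ S then 1 else 0}
  have hV : V.Finite := (Set.finite_range fun S : Finset ι =>
    (fun i => if i ∈ S then 1 else 0 : ι → ℝ)).subset fun x ⟨S, _, _, hS⟩ => ⟨S, hS.symm⟩
  have hsub : (hypersimplexOn T k).extremePoints ℝ ⊆ V := by
    intro x hx
    have h01 := extremePoints_hypersimplexOn_eq_zero_or_one hx
    obtain ⟨-, -, hT, hs⟩ := hx.1
    have hx_eq : x = fun i => if i ∈ univ.filter (fun i => x i = 1) then 1 else 0 := by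
      funext i
      rcases h01 i with h | h <;> simp [h]
    refine ⟨univ.filter (fun i => x i = 1), ?_, fun i hi => ?_, hx_eq⟩
    · rw [hx_eq, sum_boole] at hs
      simpa using hs
    · by_contra h
      simp [hT i h] at hi
  rw [← closure_convexHull_extremePoints (isCompact_hypersimplexOn T k)
    (convex_hypersimplexOn T k)]
  exact closure_minimal (convexHull_mono hsub) (hV.isClosed_convexHull ℝ)

/-- A box contains a point whose coordinate sum is any number between the extreme values. -/
lemma exists_between_sum_eq_s5 {ι : Type*} (T : Finset ι) {a b : ι → ℝ} {s : ℝ}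
    (hab : ∀ i ∈ T, a i ≤ b i) (ha : ∑ i ∈ T, a i ≤ s) (hb : s ≤ ∑ i ∈ T, b i) :
    ∃ y : ι → ℝ, (∀ i ∈ T, a i ≤ y i ∧ y i ≤ b i) ∧ ∑ i ∈ T, y i = s := by
  rcases (ha.trans hb).eq_or_lt with h | h
  · exact ⟨a, fun i hi => ⟨le_rfl, hab i hi⟩, le_antisymm ha (h ▸ hb)⟩
  · set θ := (s - ∑ i ∈ T, a i) / (∑ i ∈ T, b i - ∑ i ∈ T, a i) with hθ
    have hpos : 0 < ∑ i ∈ T, b i - ∑ i ∈ T, a i := sub_pos.2 h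
    have hθ₀ : 0 ≤ θ := div_nonneg (sub_nonneg.2 ha) hpos.le
    have hθ₁ : θ ≤ 1 := (div_le_one hpos).2 (by linarith)
    refine ⟨fun i => a i + θ * (b i - a i), fun i hi => ⟨?_, ?_⟩, ?_⟩
    · nlinarith [hab i hi]
    · nlinarith [hab i hi]
    · rw [sum_add_distrib, ← mul_sum, sum_sub_distrib, hθ, div_mul_cancel₀ _ hpos.ne']
      ring

lemma vS_eq_indicator (m : ℕ) (S : Finset (Fin (2 * m + 6))) :
    vS m S = fun i => if i ∈ S then 1 else 0 := by
  funext i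
  simp [vS, e]

lemma w_zero_apply (m : ℕ) (j k : Fin (2 * m + 6)) :
    w m 0 j k = 1 / 2 - (if k = 0 then 1 else 0) - (if k = j then 1 else 0) := rfl

/-- The polyhedron cut out by the inequalities describing `PII m`. -/
def polyhedronII (m : ℕ) : Set (Fin (2 * m + 6) → ℝ) :=
  {α | (∑ i, α i) = (m : ℝ) + 1 ∧
    -(1 / 2) ≤ α 0 ∧
    (∀ r : Fin (2 * m + 6), r ≠ 0 → α r - α 0 ≤ 1) ∧
    ∀ S : Finset (Fin (2 * m + 6)), (0 : Fin (2 * m + 6)) ∉ S → S.card ≤ m + 3 →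
      0 ≤ ((S.card : ℝ) - 2) * α 0 + ∑ j ∈ S, α j}

lemma convex_polyhedronII (m : ℕ) : Convex ℝ (polyhedronII m) := by
  rintro x ⟨hxs, hx₀, hxr, hxS⟩ y ⟨hys, hy₀, hyr, hyS⟩ a b ha hb hab
  refine ⟨?_, ?_, fun r hr => ?_, fun S h0 hS => ?_⟩ <;>
    simp only [Pi.add_apply, Pi.smul_apply, smul_eq_mul]
  · rw [sum_add_distrib, ← mul_sum, ← mul_sum, hxs, hys, ← add_mul, hab, one_mul]
  · nlinarith [mul_le_mul_of_nonneg_left hx₀ ha, mul_le_mul_of_nonneg_left hy₀ hb]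
  · nlinarith [mul_le_mul_of_nonneg_left (hxr r hr) ha, mul_le_mul_of_nonneg_left (hyr r hr) hb]
  · rw [sum_add_distrib, ← mul_sum, ← mul_sum]
    nlinarith [mul_nonneg ha (hxS S h0 hS), mul_nonneg hb (hyS S h0 hS)]

lemma vS_mem_polyhedronII (m : ℕ) {S : Finset (Fin (2 * m + 6))} (hS : #S = m + 1)
    (h0 : (0 : Fin (2 * m + 6)) ∉ S) : vS m S ∈ polyhedronII m := by
  rw [vS_eq_indicator]
  refine ⟨by simp [hS], by simp [h0], fun r _ => ?_, fun U _ _ => ?_⟩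
  · simp only [h0, if_false, sub_zero]
    split_ifs <;> norm_num
  · simp only [h0, if_false, mul_zero, zero_add]
    exact sum_nonneg fun i _ => by split_ifs <;> norm_num

lemma w_mem_polyhedronII (m : ℕ) {j : Fin (2 * m + 6)} (hj : j ≠ 0) :
    w m 0 j ∈ polyhedronII m := by
  refine ⟨?_, ?_, fun r hr => ?_, fun S h0 _ => ?_⟩
  · simp only [w_zero_apply, sum_sub_distrib, sum_const, card_univ, Fintype.card_fin, sum_ite_eq',
      mem_univ, if_true, nsmul_eq_mul]
    push_cast
    ring
  · simp only [w_zero_apply, if_true, hj.symm, if_false]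
    norm_num
  · simp only [w_zero_apply, if_true, hj.symm, hr, if_false]
    split_ifs <;> norm_num
  · simp only [w_zero_apply, sum_sub_distrib, sum_const, sum_ite_eq', h0, hj.symm, if_true,
      if_false, nsmul_eq_mul]
    split_ifs <;> linarith

lemma PII_subset_polyhedronII (m : ℕ) : PII m ⊆ polyhedronII m := by
  refine convexHull_min ?_ (convex_polyhedronII m)
  rintro x (⟨S, hS, h0, rfl⟩ | ⟨j, hj, rfl⟩)
  · exact vS_mem_polyhedronII m hS h0
  · exact w_mem_polyhedronII m hj

/-- Every point in the dilate by `c` of the hypersimplex is `c` times a point of `PII m`. -/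
lemma exists_mem_PII_smul_eq (m : ℕ) {c : ℝ} (hc : 0 ≤ c) {x : Fin (2 * m + 6) → ℝ} (hx0 : x 0 = 0)
    (h₀ : ∀ i, 0 ≤ x i) (h₁ : ∀ i, x i ≤ c) (hs : ∑ i, x i = c * (m + 1)) :
    ∃ v ∈ PII m, c • v = x := by
  rcases hc.eq_or_lt with rfl | hc
  · refine ⟨w m 0 1, subset_convexHull ℝ _ (Or.inr ⟨1, one_ne_zero, rfl⟩), ?_⟩
    funext i
    simpa using (le_antisymm (h₁ i) (h₀ i)).symm
  · refine ⟨c⁻¹ • x, ?_, smul_inv_smul₀ hc.ne' x⟩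
    have hmem : c⁻¹ • x ∈ hypersimplexOn (univ.erase (0 : Fin (2 * m + 6))) (m + 1) := by
      refine ⟨fun i => ?_, fun i => ?_, fun i hi => ?_, ?_⟩ <;>
        simp only [Pi.smul_apply, smul_eq_mul]
      · exact mul_nonneg (inv_nonneg.2 hc.le) (h₀ i)
      · rw [inv_mul_le_one₀ hc]
        exact h₁ i
      · obtain rfl : i = 0 := by simpa using hi
        simp [hx0]
      · rw [← mul_sum, hs, inv_mul_cancel_left₀ hc.ne']
        push_cast
        rfl
    refine convexHull_mono ?_ (hypersimplexOn_subset_convexHull _ _ hmem)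
    rintro _ ⟨S, hS, hST, rfl⟩
    exact Or.inl ⟨S, hS, fun h => by simpa using hST h, (vS_eq_indicator m S).symm⟩

/-- For a point of the polyhedron, the bound on partial sums holds for all sets `S`, not only
those with at most `m + 3` elements. -/
lemma neg_two_mul_le_sum_of_mem_polyhedronII {m : ℕ} {α : Fin (2 * m + 6) → ℝ}
    (hα : α ∈ polyhedronII m) {S : Finset (Fin (2 * m + 6))} (h0 : (0 : Fin (2 * m + 6)) ∉ S) :
    2 * α 0 ≤ ∑ j ∈ S, (α j + α 0) := by
  obtain ⟨hs, hα₀, hr, hS⟩ := hα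
  by_cases hcard : #S ≤ m + 3
  · have := hS S h0 hcard
    rw [sum_add_distrib, sum_const, nsmul_eq_mul]
    linarith
  · have hsub : S ⊆ univ.erase (0 : Fin (2 * m + 6)) :=
      fun i hi => mem_erase.2 ⟨fun h => h0 (h ▸ hi), mem_univ i⟩
    set U := univ.erase (0 : Fin (2 * m + 6)) \ S with hU
    have hcU : #U ≤ m + 1 := by
      rw [hU, card_sdiff_of_subset hsub, card_erase_of_mem (mem_univ _), card_univ,
        Fintype.card_fin]
      omega
    have hcU' : (#U : ℝ) ≤ m + 1 := by exact_mod_cast hcU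
    have hUle : ∑ j ∈ U, (α j + α 0) ≤ #U * (1 + 2 * α 0) := by
      rw [← nsmul_eq_mul]
      refine sum_le_card_nsmul _ _ _ fun j hj => ?_
      have := hr j (by rintro rfl; simp [hU] at hj)
      linarith
    have hmul : (#U : ℝ) * (1 + 2 * α 0) ≤ (m + 1) * (1 + 2 * α 0) :=
      mul_le_mul_of_nonneg_right hcU' (by linarith)
    have htot : ∑ j ∈ U, (α j + α 0) + ∑ j ∈ S, (α j + α 0) = m + 1 + (2 * m + 4) * α 0 := by
      rw [hU, sum_sdiff hsub, sum_add_distrib, sum_erase_eq_sub (mem_univ _), hs, sum_const,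
        card_erase_of_mem (mem_univ _), card_univ, Fintype.card_fin, nsmul_eq_mul,
        show 2 * m + 6 - 1 = 2 * m + 5 by omega]
      push_cast
      ring
    nlinarith

lemma polyhedronII_subset_PII (m : ℕ) : polyhedronII m ⊆ PII m := by
  intro α hα
  have hpart := fun S => neg_two_mul_le_sum_of_mem_polyhedronII hα (S := S)
  obtain ⟨hs, hα₀, hr, hS⟩ := hα
  have hneg : α 0 ≤ 0 := by
    have := hS ∅ (by simp) (by simp)
    simp only [card_empty, sum_empty] at this
    push_cast at this
    linarith
  set T := univ.erase (0 : Fin (2 * m + 6)) with hT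
  have hcT : (#T : ℝ) = 2 * m + 5 := by
    rw [hT, card_erase_of_mem (mem_univ _), card_univ, Fintype.card_fin,
      show 2 * m + 6 - 1 = 2 * m + 5 by omega]
    push_cast
    ring
  have hsT : ∑ i ∈ T, α i = m + 1 - α 0 := by rw [hT, sum_erase_eq_sub (mem_univ _), hs]
  obtain ⟨y, hy, hys⟩ : ∃ y : Fin (2 * m + 6) → ℝ,
      (∀ i ∈ T, max 0 (-(α i + α 0)) ≤ y i ∧ y i ≤ 1 + 2 * α 0 - (α i + α 0)) ∧
        ∑ i ∈ T, y i = -(2 * α 0) := by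
    refine exists_between_sum_eq_s5 T (fun i hi => ?_) ?_ ?_
    · have := hr i (ne_of_mem_erase hi)
      exact max_le (by linarith) (by linarith)
    · have h := hpart {i ∈ T | α i + α 0 < 0} (by simp [hT])
      have hmax : ∀ i ∈ T, max 0 (-(α i + α 0)) =
          if α i + α 0 < 0 then -(α i + α 0) else 0 := by
        intro i _
        split_ifs with hi
        · exact max_eq_right (by linarith)
        · exact max_eq_left (by linarith)
      rw [sum_congr rfl hmax, ← sum_filter, sum_neg_distrib]
      linarith
    · rw [sum_sub_distrib, sum_const, sum_add_distrib, sum_const, hsT, nsmul_eq_mul, nsmul_eq_mul,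
        hcT]
      nlinarith [mul_nonneg (Nat.cast_nonneg (α := ℝ) m) (show 0 ≤ 1 + 2 * α 0 by linarith)]
  obtain ⟨v, hv, hvx⟩ := exists_mem_PII_smul_eq m (c := 1 + 2 * α 0) (by linarith)
    (x := fun i => if i = 0 then 0 else α i + α 0 + y i) (by simp)
    (fun i => by
      split_ifs with hi
      · exact le_rfl
      · have := (le_max_right _ _).trans (hy i (by simp [hT, hi])).1
        linarith)
    (fun i => by
      split_ifs with hi
      · linarith
      · have := (hy i (by simp [hT, hi])).2
        linarith)
    (by
      rw [← add_sum_erase _ _ (mem_univ (0 : Fin (2 * m + 6))), if_pos rfl, zero_add,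
        sum_congr rfl fun i hi => if_neg (ne_of_mem_erase hi), ← hT, sum_add_distrib,
        sum_add_distrib, hsT, hys, sum_const, nsmul_eq_mul, hcT]
      ring)
  have hcomb : ∑ i, (if i = 0 then 1 + 2 * α 0 else y i) • (if i = 0 then v else w m 0 i) = α := by
    rw [← add_sum_erase _ _ (mem_univ (0 : Fin (2 * m + 6))), if_pos rfl, if_pos rfl, hvx, ← hT,
      sum_congr rfl fun i hi => by rw [if_neg (ne_of_mem_erase hi), if_neg (ne_of_mem_erase hi)]]
    funext k
    simp only [Pi.add_apply, Finset.sum_apply, Pi.smul_apply, smul_eq_mul, w_zero_apply, mul_sub,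
      sum_sub_distrib, ← sum_mul, hys, mul_ite, mul_one, mul_zero, sum_ite_eq]
    by_cases hk : k = 0
    · simp [hk, hys, hT.symm ▸ notMem_erase (0 : Fin (2 * m + 6)) univ]
      ring
    · simp [hk, hT.symm ▸ mem_erase.2 ⟨hk, mem_univ k⟩]
      ring
  rw [← hcomb]
  refine (convex_convexHull ℝ _).sum_mem (fun i _ => ?_) ?_ fun i _ => ?_
  · split_ifs with hi
    · linarith
    · exact (le_max_left _ _).trans (hy i (by simp [hT, hi])).1
  · rw [← add_sum_erase _ _ (mem_univ (0 : Fin (2 * m + 6))), if_pos rfl,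
      sum_congr rfl fun i hi => if_neg (ne_of_mem_erase hi), ← hT, hys]
    ring
  · split_ifs with hi
    · exact hv
    · exact subset_convexHull ℝ _ (Or.inr ⟨i, hi, rfl⟩)

theorem statement5 (m : ℕ) :
    PII m =
      {α : Fin (2 * m + 6) → ℝ |
        (∑ i, α i) = (m : ℝ) + 1 ∧
        -(1 / 2) ≤ α 0 ∧
        (∀ r : Fin (2 * m + 6), r ≠ 0 → α r - α 0 ≤ 1) ∧
        ∀ S : Finset (Fin (2 * m + 6)), (0 : Fin (2 * m + 6)) ∉ S → S.card ≤ m + 3 →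
          0 ≤ ((S.card : ℝ) - 2) * α 0 + ∑ j ∈ S, α j} := by
  exact (PII_subset_polyhedronII m).antisymm (polyhedronII_subset_PII m)
end
end
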